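/- For all j ≥ 1, F_{j+2} - j - 2 ≤ ((3+√5)/2)·F_j - j - (1+√5)/2, where F_1 = 1, F_2 = 2 is the shifted Fibonacci sequence. -/

import Mathlib

/-- For j ≥ 1, F_{j+2} - j - 2 ≤ ((3+√5)/2)·F_j - j - (1+√5)/2, with F_i = fib (i+1). -/
theorem a_j_le_golden_bound (j : ℕ) (hj : 1 ≤ j) :
    (Nat.fib (j + 3) : ℝ) - j - 2
      ≤ ((3 + Real.sqrt 5) / 2) * (Nat.fib (j + 1) : ℝ) - j - (1 + Real.sqrt 5) / 2 := by
  obtain ⟨k, rfl⟩ : ∃ k, j = k + 1 := ⟨j - 1, by omega⟩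
  have h := Real.fib_succ_sub_goldenRatio_mul_fib (k + 2)
  have hf : (Nat.fib (k + 1 + 3) : ℝ) = Nat.fib (k + 2) + Nat.fib (k + 2 + 1) := by
    rw [← Nat.cast_add]
    exact congrArg _ (Nat.fib_add_two (n := k + 2))
  have habs : |Real.goldenConj| ≤ 1 :=
    abs_le.mpr ⟨Real.neg_one_lt_goldenConj.le, Real.goldenConj_neg.le.trans zero_le_one⟩
  have hk : Real.goldenConj ^ k ≤ 1 :=
    (le_abs_self _).trans (by rw [abs_pow]; exact pow_le_one₀ (abs_nonneg _) habs)
  have h2 : Real.goldenConj ^ (k + 2) ≤ Real.goldenConj + 1 := by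
    rw [pow_add, Real.goldenConj_sq]
    have := Real.neg_one_lt_goldenConj
    nlinarith
  rw [← h] at h2
  rw [hf]
  simp only [Real.goldenRatio, Real.goldenConj] at h2
  rw [show k + 1 + 1 = k + 2 from rfl]
  linarith
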